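/- Let k ≥ 3 and let p = p_1 ⋯ p_n be a permutation avoiding A_{k,k-1}. If j is the smallest index such that the rank of p_j is at least k-1 (assuming such an index exists), then the suffix p_j, p_{j+1}, …, p_n is decreasing: p_j > p_{j+1} > ⋯ > p_n. -/

import Mathlib

/-- A permutation `p` of length `n` contains the pattern `q` of length `k` if there
are positions `i₁ < i₂ < ⋯ < i_k` whose entries are order-isomorphic to `q`. -/
def Contains {n k : ℕ} (p : Equiv.Perm (Fin n)) (q : Equiv.Perm (Fin k)) : Prop :=
  ∃ f : Fin k → Fin n, StrictMono f ∧ ∀ r s : Fin k, q r < q s ↔ p (f r) < p (f s)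

/-- `p` avoids every pattern in the set `S` of patterns of length `k`. -/
def AvoidsSet {n k : ℕ} (p : Equiv.Perm (Fin n)) (S : Set (Equiv.Perm (Fin k))) : Prop :=
  ∀ q ∈ S, ¬ Contains p q

/-- `A_k`: the set of patterns of length `k` whose first `k-1` entries are increasing. -/
def Ak (k : ℕ) : Set (Equiv.Perm (Fin k)) :=
  { q | ∀ r s : Fin k, (r : ℕ) < (s : ℕ) → (s : ℕ) < k - 1 → q r < q s }

/-- `A_{k,i}`: the set `A_k` with the pattern ending in `i` removed (entries of patterns
are thought of as `1`-indexed values `1,…,k`, so value `i` corresponds to `i-1 : Fin k`). -/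
def Aki (k i : ℕ) : Set (Equiv.Perm (Fin k)) :=
  { q ∈ Ak k | ∀ j : Fin k, (j : ℕ) = k - 1 → (q j : ℕ) ≠ i - 1 }

/-- The number of permutations of length `n` avoiding the set of patterns `S`. -/
noncomputable def avSet (n : ℕ) {k : ℕ} (S : Set (Equiv.Perm (Fin k))) : ℕ :=
  Nat.card { p : Equiv.Perm (Fin n) // AvoidsSet p S }

/-- The number of permutations of length `n` avoiding the single pattern `q`. -/
noncomputable def avPat (n : ℕ) {k : ℕ} (q : Equiv.Perm (Fin k)) : ℕ :=
  Nat.card { p : Equiv.Perm (Fin n) // ¬ Contains p q }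

/-- The rank of the entry in position `j` of `p`: the length of the longest increasing
subsequence of `p` ending in `p j`. -/
noncomputable def rank {n : ℕ} (p : Equiv.Perm (Fin n)) (j : Fin n) : ℕ :=
  sSup { m : ℕ | ∃ f : Fin m → Fin n, StrictMono f ∧ StrictMono (p ∘ f) ∧
    (∀ r, f r ≤ j) ∧ (∃ r, f r = j) }

theorem exists_std {k n : ℕ} (h : Fin k → Fin n) (hi : Function.Injective h) :
    ∃ q : Equiv.Perm (Fin k), ∀ r s, q r < q s ↔ h r < h s := by
  classical
  have hc : (Finset.univ.image h).card = k := by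
    rw [Finset.card_image_of_injective _ hi]; simp
  let e := (Finset.univ.image h).orderIsoOfFin hc
  let t : Fin k → Fin k := fun r => e.symm ⟨h r, by simp⟩
  have ht : ∀ r s, t r < t s ↔ h r < h s := by
    intro r s
    simp [t]
  have hti : Function.Injective t := by
    intro r s hrs
    apply hi
    have h1 := ht r s
    have h2 := ht s r
    rw [hrs] at h1 h2
    simp at h1 h2
    exact le_antisymm h2 h1
  refine ⟨Equiv.ofBijective t (Finite.injective_iff_bijective.mp hti), ?_⟩
  intro r s
  simpa using ht r s

theorem snoc_strictMono {α : Type*} [Preorder α] {d : ℕ} (a : Fin (d + 1) → α) (ha : StrictMono a)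
    (m : α) (hm : a (Fin.last d) < m) : StrictMono (Fin.snoc a m : Fin (d + 2) → α) := by
  intro r s hrs
  induction s using Fin.lastCases with
  | last =>
    induction r using Fin.lastCases with
    | last => exact absurd hrs (lt_irrefl _)
    | cast r =>
      simp only [Fin.snoc_castSucc, Fin.snoc_last]
      exact (ha.monotone (Fin.le_last r)).trans_lt hm
  | cast s =>
    induction r using Fin.lastCases with
    | last => exact absurd hrs (not_lt.mpr (Fin.le_last _))
    | cast r =>
      simp only [Fin.snoc_castSucc]
      exact ha (by simpa using hrs)

theorem key {d n : ℕ} (p : Equiv.Perm (Fin n)) (hp : AvoidsSet p (Aki (d + 3) (d + 2)))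
    (a : Fin (d + 2) → Fin n) (ha : StrictMono a) (hpa : StrictMono (p ∘ a)) (m : Fin n)
    (hm : a (Fin.last (d + 1)) < m) :
    p (a (Fin.last d).castSucc) < p m ∧ p m < p (a (Fin.last (d + 1))) := by
  have hg := snoc_strictMono a ha m hm
  set g : Fin (d + 3) → Fin n := Fin.snoc a m with hgdef
  obtain ⟨q, hq⟩ := exists_std (p ∘ g) (p.injective.comp hg.injective)
  have hgc : ∀ i : Fin (d + 2), g i.castSucc = a i := fun i => by simp [hgdef]
  have hgl : g (Fin.last _) = m := by simp [hgdef]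
  have hinc : ∀ r s : Fin (d + 2), r < s → q r.castSucc < q s.castSucc := by
    intro r s hrs
    rw [hq]
    simp only [Function.comp, hgc]
    exact hpa hrs
  have hA : q ∈ Ak (d + 3) := by
    intro r s hrs hs
    exact hinc ⟨r, by omega⟩ ⟨s, by omega⟩ hrs
  have hlast : (q (Fin.last (d + 2)) : ℕ) = d + 1 := by
    by_contra hne
    refine hp q ⟨hA, ?_⟩ ⟨g, hg, hq⟩
    intro i hi
    have : i = Fin.last (d + 2) := Fin.ext (by simpa using hi)
    subst this
    simpa using hne
  have hbig : d + 2 ≤ (q (Fin.last (d + 1)).castSucc : ℕ) := by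
    obtain ⟨r, hr⟩ := q.surjective (Fin.last (d + 2))
    induction r using Fin.lastCases with
    | last => rw [hr] at hlast; simp at hlast
    | cast r =>
      rcases (Fin.le_last r).lt_or_eq with h | h
      · have := hinc _ _ h
        rw [hr] at this
        exact absurd this (not_lt.mpr (Fin.le_last _))
      · rw [← h, hr]; simp
  have hsm := hinc (Fin.last d).castSucc (Fin.last (d + 1)) (Fin.castSucc_lt_last _)
  have hne : q (Fin.last d).castSucc.castSucc ≠ q (Fin.last (d + 2)) := by
    intro h
    exact (Fin.castSucc_lt_last _).ne (q.injective h)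
  have hne' : (q (Fin.last d).castSucc.castSucc : ℕ) ≠ q (Fin.last (d + 2)) :=
    fun h => hne (Fin.ext h)
  have hlt := (q (Fin.last (d + 1)).castSucc).isLt
  have hsm' := Fin.lt_def.mp hsm
  constructor
  · have := (hq (Fin.last d).castSucc.castSucc (Fin.last (d + 2))).mp
      (Fin.lt_def.mpr (by omega))
    simpa only [Function.comp, hgc, hgl] using this
  · have := (hq (Fin.last (d + 2)) (Fin.last (d + 1)).castSucc).mp
      (Fin.lt_def.mpr (by omega))
    simpa only [Function.comp, hgc, hgl] using this

theorem exists_chain {n d : ℕ} (p : Equiv.Perm (Fin n)) (j : Fin n) (hj : d + 1 ≤ rank p j) :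
    ∃ a : Fin (d + 1) → Fin n, StrictMono a ∧ StrictMono (p ∘ a) ∧ a (Fin.last d) = j := by
  have hmem := Nat.sSup_mem (s := { m : ℕ | ∃ f : Fin m → Fin n, StrictMono f ∧
    StrictMono (p ∘ f) ∧ (∀ r, f r ≤ j) ∧ (∃ r, f r = j) })
    ⟨1, fun _ => j, Subsingleton.strictMono _, Subsingleton.strictMono _, fun _ => le_rfl, 0, rfl⟩
    ⟨n, by
      rintro m ⟨f, hf, -⟩
      simpa using Fintype.card_le_of_injective f hf.injective⟩
  change rank p j ∈ _ at hmem
  generalize rank p j = m at hj hmem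
  obtain ⟨f, hf, hpf, hle, r, hr⟩ := hmem
  let c : Fin (d + 1) → Fin m := fun i => ⟨m - (d + 1) + i, by omega⟩
  have hc : StrictMono c := by
    intro x y hxy
    simp only [c, Fin.lt_def] at hxy ⊢
    omega
  refine ⟨f ∘ c, hf.comp hc, hpf.comp hc, le_antisymm (hle _) ?_⟩
  rw [← hr]
  apply hf.monotone
  simp only [c, Fin.le_def, Fin.val_last]
  omega

theorem stmt12 (k n : ℕ) (hk : 3 ≤ k) (p : Equiv.Perm (Fin n))
    (hp : AvoidsSet p (Aki k (k - 1))) (j : Fin n)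
    (hj : k - 1 ≤ rank p j) (hmin : ∀ m : Fin n, m < j → rank p m < k - 1) :
    ∀ m₁ m₂ : Fin n, j ≤ m₁ → m₁ < m₂ → p m₂ < p m₁ := by
  obtain ⟨d, rfl⟩ : ∃ d, k = d + 3 := ⟨k - 3, by omega⟩
  obtain ⟨a, ha, hpa, haj⟩ := exists_chain (d := d + 1) p j hj
  intro m₁ m₂ h1 h2
  rcases h1.eq_or_lt with rfl | h1
  · have := (key p hp a ha hpa m₂ (by rw [haj]; exact h2)).2
    rwa [haj] at this
  · have h3 := (key p hp a ha hpa m₁ (by rw [haj]; exact h1)).1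
    have hc : StrictMono (Fin.castSucc : Fin (d + 1) → Fin (d + 2)) := Fin.strictMono_castSucc
    have hb := snoc_strictMono (a ∘ Fin.castSucc) (ha.comp hc) m₁
      ((ha (Fin.castSucc_lt_last _)).trans (by rw [haj]; exact h1))
    have hpb := snoc_strictMono (p ∘ a ∘ Fin.castSucc) (hpa.comp hc) (p m₁) h3
    have := (key p hp (Fin.snoc (a ∘ Fin.castSucc) m₁) hb
      (by rw [Fin.comp_snoc]; exact hpb) m₂ (by simpa using h2)).2
    simpa using this
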